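/- arXiv:math/0306406 — 4 statements merged into one kernel-verified Lean document; each statement's English description precedes it below -/
import Mathlib

section
/- Let k be a field of characteristic zero and A a commutative k-algebra. Regard A ⊗_k A as an A-module via a'·(x ⊗ y) = (a'x) ⊗ y. The A-linear map A ⊗_k A → Ω_{A/k} sending a ⊗ b to a·D(b) (where D : A → Ω_{A/k} is the universal derivation into the module of Kähler differentials) is surjective, and its kernel is exactly the k-linear span (equivalently, the A-submodule generated) of the elements ab ⊗ c − a ⊗ bc + ca ⊗ b for a, b, c ∈ A. Consequently, the quotient of A ⊗_k A by the image of the Hochschild boundary map A ⊗_k A ⊗_k A → A ⊗_k A, a ⊗ b ⊗ c ↦ ab ⊗ c − a ⊗ bc + ca ⊗ b, is isomorphic as an A-module to Ω_{A/k}. -/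
open TensorProduct

namespace KaehlerDifferential

variable (R A : Type*) [CommRing R] [CommRing A] [Algebra R A]

/-- The images `ab ⊗ c − a ⊗ bc + ca ⊗ b` of pure tensors under the Hochschild boundary. -/
def hochschildBoundaries : Set (A ⊗[R] A) :=
  {x | ∃ a b c : A, x = (a * b) ⊗ₜ[R] c - a ⊗ₜ[R] (b * c) + (c * a) ⊗ₜ[R] b}

/-- The `A`-linear map `A ⊗[R] A → Ω[A⁄R]`, `a ⊗ b ↦ a • D b`. -/
noncomputable def ofTensor : A ⊗[R] A →ₗ[A] Ω[A⁄R] :=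
  (D R A).toLinearMap.liftBaseChange A

@[simp]
lemma ofTensor_tmul (a b : A) : ofTensor R A (a ⊗ₜ b) = a • D R A b := by
  simp [ofTensor]

lemma ofTensor_surjective : Function.Surjective (ofTensor R A) := by
  rw [← LinearMap.range_eq_top, eq_top_iff, ← span_range_derivation, Submodule.span_le]
  rintro _ ⟨b, rfl⟩
  exact ⟨1 ⊗ₜ b, by simp⟩

/-- The derivation `b ↦ 1 ⊗ b` into the quotient of `A ⊗[R] A` by the Hochschild boundaries. -/
noncomputable def hochschildDerivation :
    Derivation R A ((A ⊗[R] A) ⧸ Submodule.span A (hochschildBoundaries R A)) :=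
  Derivation.mk'
    ((Submodule.mkQ (Submodule.span A (hochschildBoundaries R A))).restrictScalars R ∘ₗ
      TensorProduct.mk R A A 1) fun b c ↦ by
    have h : (1 * b) ⊗ₜ[R] c - 1 ⊗ₜ[R] (b * c) + (c * 1) ⊗ₜ[R] b ∈
        Submodule.span A (hochschildBoundaries R A) :=
      Submodule.subset_span ⟨1, b, c, rfl⟩
    simp only [LinearMap.comp_apply, LinearMap.restrictScalars_apply, TensorProduct.mk_apply,
      ← map_smul, ← map_add]
    rw [eq_comm, Submodule.mkQ_apply, Submodule.mkQ_apply, Submodule.Quotient.eq]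
    convert h using 1
    simp only [TensorProduct.smul_tmul', smul_eq_mul, mul_one, one_mul]
    abel

lemma hochschildDerivation_liftKaehlerDifferential_comp_ofTensor :
    (hochschildDerivation R A).liftKaehlerDifferential ∘ₗ ofTensor R A =
      Submodule.mkQ (Submodule.span A (hochschildBoundaries R A)) := by
  ext b
  simp [hochschildDerivation]

/-- The kernel of `a ⊗ b ↦ a • D b` is spanned by the Hochschild boundaries. -/
theorem ker_ofTensor :
    LinearMap.ker (ofTensor R A) = Submodule.span A (hochschildBoundaries R A) := by
  apply le_antisymm
  · conv_rhs => rw [← Submodule.ker_mkQ (Submodule.span A (hochschildBoundaries R A)),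
      ← hochschildDerivation_liftKaehlerDifferential_comp_ofTensor]
    exact LinearMap.ker_le_ker_comp _ _
  · rw [Submodule.span_le]
    rintro _ ⟨a, b, c, rfl⟩
    simp only [SetLike.mem_coe, LinearMap.mem_ker, map_add, map_sub, ofTensor_tmul,
      Derivation.leibniz, smul_add, smul_smul, mul_comm c a]
    abel

lemma smul_mem_hochschildBoundaries (r : A) {x : A ⊗[R] A} (hx : x ∈ hochschildBoundaries R A) :
    r • x ∈ hochschildBoundaries R A := by
  obtain ⟨a, b, c, rfl⟩ := hx
  refine ⟨r * a, b, c, ?_⟩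
  simp only [smul_add, smul_sub, TensorProduct.smul_tmul', smul_eq_mul, mul_assoc,
    mul_left_comm c r a]

/-- The `R`-span of the Hochschild boundaries is already an `A`-submodule. -/
lemma coe_span_hochschildBoundaries :
    (Submodule.span A (hochschildBoundaries R A) : Set (A ⊗[R] A)) =
      Submodule.span R (hochschildBoundaries R A) := by
  apply Set.Subset.antisymm
  · intro x hx
    induction hx using Submodule.span_induction with
    | mem x hx => exact Submodule.subset_span hx
    | zero => exact Submodule.zero_mem _
    | add x y _ _ hx hy => exact Submodule.add_mem _ hx hy
    | smul r x _ hx =>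
      have h : Submodule.span R (hochschildBoundaries R A) ≤
          (Submodule.span R (hochschildBoundaries R A)).comap
            (LinearMap.lsmul A (A ⊗[R] A) r |>.restrictScalars R) :=
        Submodule.span_le.2 fun y hy ↦
          Submodule.subset_span (smul_mem_hochschildBoundaries R A r hy)
      exact h hx
  · exact Submodule.span_le_restrictScalars R A _

end KaehlerDifferential

/-- For a commutative algebra `A` over a field `k` of characteristic zero,
the `A`-linear map `A ⊗[k] A → Ω[A⁄k]`, `a ⊗ b ↦ a • D b`, is surjective with kernel
exactly the span of the Hochschild boundaries `ab ⊗ c − a ⊗ bc + ca ⊗ b`; hence the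
quotient of `A ⊗[k] A` by these boundaries is `A`-linearly isomorphic to `Ω[A⁄k]`. -/
theorem tensor_to_kaehler_surjective_ker_hochschild
    (k : Type*) [Field k] [CharZero k] (A : Type*) [CommRing A] [Algebra k A] :
    ∃ φ : (A ⊗[k] A) →ₗ[A] Ω[A⁄k],
      (∀ a b : A, φ (a ⊗ₜ[k] b) = a • KaehlerDifferential.D k A b) ∧
      Function.Surjective φ ∧
      LinearMap.ker φ = Submodule.span A
        {x : A ⊗[k] A | ∃ a b c : A,
          x = (a * b) ⊗ₜ[k] c - a ⊗ₜ[k] (b * c) + (c * a) ⊗ₜ[k] b} ∧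
      (LinearMap.ker φ : Set (A ⊗[k] A)) = (Submodule.span k
        {x : A ⊗[k] A | ∃ a b c : A,
          x = (a * b) ⊗ₜ[k] c - a ⊗ₜ[k] (b * c) + (c * a) ⊗ₜ[k] b} : Set (A ⊗[k] A)) ∧
      Nonempty (((A ⊗[k] A) ⧸ Submodule.span A
        {x : A ⊗[k] A | ∃ a b c : A,
          x = (a * b) ⊗ₜ[k] c - a ⊗ₜ[k] (b * c) + (c * a) ⊗ₜ[k] b}) ≃ₗ[A] Ω[A⁄k]) := by
  open KaehlerDifferential in
  exact ⟨ofTensor k A, ofTensor_tmul k A, ofTensor_surjective k A, ker_ofTensor k A,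
    (congrArg _ (ker_ofTensor k A)).trans (coe_span_hochschildBoundaries k A),
    ⟨(Submodule.quotEquivOfEq _ _ (ker_ofTensor k A).symm).trans
      ((ofTensor k A).quotKerEquivOfSurjective (ofTensor_surjective k A))⟩⟩
end

section
/- Let k be a field of characteristic zero, let A be a polynomial algebra over k (the algebra of multivariate polynomials in an arbitrary set of variables), and let M be an A-module. Suppose f : A × A → M is a k-bilinear map which is symmetric, f(a,b) = f(b,a), and satisfies the Hochschild 2-cocycle identity a·f(b,c) − f(ab, c) + f(a, bc) − c·f(a,b) = 0 for all a, b, c ∈ A. Then f is a coboundary: there exists a k-linear map g : A → M such that f(a,b) = a·g(b) + b·g(a) − g(ab) for all a, b ∈ A. -/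
/-- A symmetric Hochschild 2-cocycle on the commutative `k`-algebra `A` with values in `M`. -/
structure SymmetricTwoCocycle (k A M : Type*) [CommRing k] [CommRing A] [Algebra k A]
    [AddCommGroup M] [Module k M] [Module A M] where
  /-- The underlying bilinear map. -/
  toBilin : A →ₗ[k] A →ₗ[k] M
  symm : ∀ a b, toBilin a b = toBilin b a
  cocycle : ∀ a b c,
    a • toBilin b c - toBilin (a * b) c + toBilin a (b * c) - c • toBilin a b = 0

namespace SymmetricTwoCocycle

variable {k A M : Type*} [CommRing k] [CommRing A] [Algebra k A]
  [AddCommGroup M] [Module k M] [Module A M]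

theorem one_left (f : SymmetricTwoCocycle k A M) (a : A) :
    f.toBilin 1 a = a • f.toBilin 1 1 := by
  have h := f.cocycle 1 1 a
  simp only [one_smul, one_mul, sub_self, zero_add] at h
  exact sub_eq_zero.mp h

/-- The square-zero extension of `A` by `M` defined by a symmetric 2-cocycle `f`: the module `A × M`
with multiplication `(a, m) * (b, n) = (a * b, a • n + b • m + f a b)`. -/
def Extension (_ : SymmetricTwoCocycle k A M) : Type _ := A × M

namespace Extension

variable (f : SymmetricTwoCocycle k A M)

instance : AddCommGroup f.Extension := inferInstanceAs (AddCommGroup (A × M))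

instance : Module k f.Extension := inferInstanceAs (Module k (A × M))

/-- The projection to the module `M`, which is only `k`-linear. -/
def snd : f.Extension →ₗ[k] M := LinearMap.snd k A M

instance : Mul f.Extension :=
  ⟨fun x y => (x.1 * y.1, x.1 • y.2 + y.1 • x.2 + f.toBilin x.1 y.1)⟩

instance : One f.Extension := ⟨(1, -f.toBilin 1 1)⟩

variable {f}

@[ext]
theorem ext {x y : f.Extension} (h₁ : x.1 = y.1) (h₂ : x.2 = y.2) : x = y := Prod.ext h₁ h₂

@[simp] theorem fst_add (x y : f.Extension) : (x + y).1 = x.1 + y.1 := rfl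
@[simp] theorem snd_add (x y : f.Extension) : (x + y).2 = x.2 + y.2 := rfl
@[simp] theorem fst_zero : (0 : f.Extension).1 = 0 := rfl
@[simp] theorem snd_zero : (0 : f.Extension).2 = 0 := rfl
@[simp] theorem fst_smul (r : k) (x : f.Extension) : (r • x).1 = r • x.1 := rfl
@[simp] theorem snd_smul (r : k) (x : f.Extension) : (r • x).2 = r • x.2 := rfl
@[simp] theorem fst_mul (x y : f.Extension) : (x * y).1 = x.1 * y.1 := rfl
@[simp] theorem snd_mul (x y : f.Extension) :
    (x * y).2 = x.1 • y.2 + y.1 • x.2 + f.toBilin x.1 y.1 := rfl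
@[simp] theorem fst_one : (1 : f.Extension).1 = 1 := rfl
@[simp] theorem snd_one : (1 : f.Extension).2 = -f.toBilin 1 1 := rfl

protected theorem mul_comm (x y : f.Extension) : x * y = y * x := by
  ext
  · simp [mul_comm]
  · simp only [snd_mul, f.symm x.1 y.1]
    abel

protected theorem one_mul (x : f.Extension) : 1 * x = x := by
  ext
  · simp
  · simp [f.one_left x.1]

protected theorem mul_assoc (x y z : f.Extension) : x * y * z = x * (y * z) := by
  ext
  · simp [mul_assoc]
  · have h : x.1 • f.toBilin y.1 z.1 + f.toBilin x.1 (y.1 * z.1) =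
        f.toBilin (x.1 * y.1) z.1 + z.1 • f.toBilin x.1 y.1 := by
      rw [← sub_eq_zero, ← f.cocycle x.1 y.1 z.1]
      abel
    simp only [snd_mul, fst_mul, smul_add, smul_smul, mul_comm z.1, add_assoc]
    rw [add_left_comm (x.1 • _), h, add_comm (z.1 • _)]

protected theorem mul_add (x y z : f.Extension) : x * (y + z) = x * y + x * z := by
  ext
  · simp [mul_add]
  · simp only [snd_mul, snd_add, fst_add, smul_add, add_smul, map_add]
    abel

instance : CommRing f.Extension where
  __ := (inferInstance : AddCommGroup f.Extension)
  mul_assoc := Extension.mul_assoc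
  one_mul := Extension.one_mul
  mul_one x := by rw [Extension.mul_comm, Extension.one_mul]
  mul_comm := Extension.mul_comm
  left_distrib := Extension.mul_add
  right_distrib x y z := by simp only [Extension.mul_comm _ z, Extension.mul_add]
  zero_mul x := by ext <;> simp
  mul_zero x := by ext <;> simp

variable [IsScalarTower k A M]

protected theorem smul_mul (r : k) (x y : f.Extension) : r • x * y = r • (x * y) := by
  ext
  · simp
  · simp [smul_comm r y.1 x.2]

instance : Algebra k f.Extension :=
  Algebra.ofModule Extension.smul_mul fun r x y => by
    rw [mul_comm, Extension.smul_mul, mul_comm]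

variable (f) in
/-- The projection of the extension onto `A`. -/
def fst : f.Extension →ₐ[k] A :=
  AlgHom.ofLinearMap (LinearMap.fst k A M) rfl fun _ _ => rfl

end Extension

/-- A symmetric 2-cocycle whose extension is split by an algebra map is a coboundary. -/
theorem exists_coboundary_of_section [IsScalarTower k A M] (f : SymmetricTwoCocycle k A M)
    (s : A →ₐ[k] f.Extension) (hs : (Extension.fst f).comp s = AlgHom.id k A) :
    ∃ g : A →ₗ[k] M, ∀ a b, f.toBilin a b = a • g b + b • g a - g (a * b) := by
  have hs_fst (a : A) : (s a).1 = a := DFunLike.congr_fun hs a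
  refine ⟨-(Extension.snd f ∘ₗ s.toLinearMap), fun a b => ?_⟩
  have h : (s (a * b)).2 = a • (s b).2 + b • (s a).2 + f.toBilin a b := by
    rw [map_mul, Extension.snd_mul, hs_fst, hs_fst]
  change f.toBilin a b = a • -(s b).2 + b • -(s a).2 - -(s (a * b)).2
  rw [h, smul_neg, smul_neg]
  abel

end SymmetricTwoCocycle

/-- Triviality of symmetric Hochschild 2-cocycles on a polynomial algebra
over a field of characteristic zero. -/
theorem symmetric_two_cocycle_is_coboundary
    {k : Type*} [Field k] [CharZero k] {σ : Type*}
    {M : Type*} [AddCommGroup M] [Module k M]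
    [Module (MvPolynomial σ k) M] [IsScalarTower k (MvPolynomial σ k) M]
    (f : MvPolynomial σ k →ₗ[k] MvPolynomial σ k →ₗ[k] M)
    (hsymm : ∀ a b : MvPolynomial σ k, f a b = f b a)
    (hcocycle : ∀ a b c : MvPolynomial σ k,
      a • f b c - f (a * b) c + f a (b * c) - c • f a b = 0) :
    ∃ g : MvPolynomial σ k →ₗ[k] M,
      ∀ a b : MvPolynomial σ k, f a b = a • g b + b • g a - g (a * b) := by
  let F : SymmetricTwoCocycle k (MvPolynomial σ k) M := ⟨f, hsymm, hcocycle⟩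
  let lift (i : σ) : F.Extension := (MvPolynomial.X i, 0)
  refine F.exists_coboundary_of_section (MvPolynomial.aeval lift)
    (MvPolynomial.algHom_ext fun i => ?_)
  rw [AlgHom.comp_apply, MvPolynomial.aeval_X]
  rfl
end

section
/- Fix a field k of characteristic zero and let (A, ℬ, d) be a connected cochain cdga over k. Let G₀ be a graded derivation of A of degree −1 and set D := d ∘ G₀ + G₀ ∘ d. Then: (1) D is a graded derivation of A of degree 0 and D commutes with d; (2) if D is locally nilpotent (for every a ∈ A there is N with D^N(a) = 0), then exp(D) = Σ_{n≥0} D^n/n! is an automorphism of the cdga A (a k-algebra automorphism preserving each ℬ i and commuting with d), and exp(D) is homotopic to the identity: there exists a homomorphism of differential graded algebras Φ : A → A[t,dt] with e₀ ∘ Φ = id_A and e₁ ∘ Φ = exp(D). -/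
/-- The degree-`n` piece of an `ℕ`-graded space, for an integer `n`
(zero in negative degrees). -/
def gpiece {k A : Type*} [Field k] [Ring A] [Algebra k A]
    (ℬ : ℕ → Submodule k A) (n : ℤ) : Submodule k A :=
  if 0 ≤ n then ℬ n.toNat else ⊥

/-- Apply a linear map to a polynomial coefficientwise. -/
noncomputable def cmap {k A : Type*} [Field k] [Ring A] [Algebra k A]
    (f : A →ₗ[k] A) (p : Polynomial A) : Polynomial A :=
  p.sum fun n a => Polynomial.C (f a) * Polynomial.X ^ n

/-- `F₁ : A → A` is homotopic to the identity through the concrete model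
`A[t,dt] = A[t] ⊕ A[t]·dt`: there is a dga homomorphism `Φ = F + G·dt : A → A[t,dt]`
(`F, G : A → A[t]`, with the multiplication rule `dt·a = (−1)^{|a|} a·dt` encoded by the
sign involution `σ`, and differential `d(a·t^n) = d(a)·t^n + (−1)^{|a|}·n·a·t^{n−1}·dt`,
`d(a·t^n·dt) = d(a)·t^n·dt`) such that `e₀ ∘ Φ = id` and `e₁ ∘ Φ = F₁`, where
`e₀, e₁` are evaluation at `t = 0, 1` with `dt ↦ 0`. -/
noncomputable def IsHomotopicToId {k A : Type*} [Field k] [Ring A] [Algebra k A]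
    (ℬ : ℕ → Submodule k A) (d σ : A →ₗ[k] A) (F₁ : A → A) : Prop :=
  ∃ F G : A →ₗ[k] Polynomial A,
    (∀ a b : A, F (a * b) = F a * F b) ∧
    (∀ a b : A, G (a * b) = F a * G b + G a * cmap σ (F b)) ∧
    F 1 = 1 ∧ G 1 = 0 ∧
    (∀ a : A, F (d a) = cmap d (F a)) ∧
    (∀ a : A, G (d a) = Polynomial.derivative (cmap σ (F a)) + cmap d (G a)) ∧
    (∀ i : ℕ, ∀ a ∈ ℬ i, ∀ n : ℕ, (F a).coeff n ∈ ℬ i) ∧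
    (∀ i : ℕ, ∀ a ∈ ℬ i, ∀ n : ℕ, (G a).coeff n ∈ gpiece ℬ ((i : ℤ) - 1)) ∧
    (∀ a : A, (F a).coeff 0 = a) ∧
    (∀ a : A, Polynomial.eval 1 (F a) = F₁ a)

section CoefficientwiseMaps

variable {k A : Type*} [Field k] [Ring A] [Algebra k A]

theorem coeff_cmap (f : A →ₗ[k] A) (p : Polynomial A) (n : ℕ) :
    (cmap f p).coeff n = f (p.coeff n) := by
  simp only [cmap, Polynomial.sum_def, Polynomial.finsetSum_coeff, Polynomial.coeff_C_mul_X_pow]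
  rw [Finset.sum_ite_eq]
  split_ifs with h
  · rfl
  · rw [Polynomial.notMem_support_iff.mp h, map_zero]

theorem eval_one_cmap (f : A →ₗ[k] A) (p : Polynomial A) :
    (cmap f p).eval 1 = f (p.eval 1) := by
  have h : (cmap f p).natDegree < p.natDegree + 1 := by
    refine Nat.lt_succ_of_le (Polynomial.natDegree_le_iff_coeff_eq_zero.mpr fun m hm => ?_)
    rw [coeff_cmap, Polynomial.coeff_eq_zero_of_natDegree_lt hm, map_zero]
  rw [Polynomial.eval_eq_sum_range' h, Polynomial.eval_eq_sum_range]
  simp [coeff_cmap]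

end CoefficientwiseMaps

section DividedPowers

variable {k A : Type*} [Field k] [Ring A] [Algebra k A]

/-- The divided power `Dⁿ / n!` of an endomorphism. -/
noncomputable def dividedPow (D : A →ₗ[k] A) (n : ℕ) : A →ₗ[k] A :=
  (n.factorial : k)⁻¹ • D ^ n

theorem dividedPow_zero (D : A →ₗ[k] A) (a : A) : dividedPow D 0 a = a := by
  simp [dividedPow]

theorem dividedPow_mem {D : A →ₗ[k] A} {S : Submodule k A} (hS : ∀ a ∈ S, D a ∈ S)
    (n : ℕ) {a : A} (ha : a ∈ S) : dividedPow D n a ∈ S := by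
  refine S.smul_mem _ ?_
  induction n with
  | zero => simpa using ha
  | succ n ih => rw [pow_succ']; exact hS _ ih

theorem dividedPow_apply_of_commute {D f : A →ₗ[k] A} (h : Commute D f) (n : ℕ) (a : A) :
    dividedPow D n (f a) = f (dividedPow D n a) := by
  have := LinearMap.congr_fun (h.pow_left n).eq a
  simp only [Module.End.mul_apply] at this
  simp [dividedPow, this]

theorem succ_smul_dividedPow_succ [CharZero k] (D : A →ₗ[k] A) (n : ℕ) (a : A) :
    ((n : k) + 1) • dividedPow D (n + 1) a = D (dividedPow D n a) := by
  have h : (n : k) + 1 ≠ 0 := by exact_mod_cast n.succ_ne_zero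
  simp only [dividedPow, LinearMap.smul_apply, map_smul, pow_succ', Module.End.mul_apply,
    Nat.factorial_succ, smul_smul]
  congr 1
  push_cast
  field_simp

/-- The Leibniz rule for the divided powers of a derivation. -/
theorem dividedPow_mul [CharZero k] {D : A →ₗ[k] A}
    (hD : ∀ a b, D (a * b) = D a * b + a * D b) (n : ℕ) (a b : A) :
    dividedPow D n (a * b) =
      ∑ p ∈ Finset.HasAntidiagonal.antidiagonal n, dividedPow D p.1 a * dividedPow D p.2 b := by
  induction n with
  | zero => simp [dividedPow_zero]
  | succ n ih =>
    have h : (n : k) + 1 ≠ 0 := by exact_mod_cast n.succ_ne_zero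
    refine smul_right_injective A h ?_
    change ((n : k) + 1) • _ = ((n : k) + 1) • _
    have hsplit : ((n : k) + 1) • ∑ p ∈ Finset.HasAntidiagonal.antidiagonal (n + 1),
          dividedPow D p.1 a * dividedPow D p.2 b =
        (∑ p ∈ Finset.HasAntidiagonal.antidiagonal (n + 1),
          (p.1 : k) • (dividedPow D p.1 a * dividedPow D p.2 b)) +
        ∑ p ∈ Finset.HasAntidiagonal.antidiagonal (n + 1),
          (p.2 : k) • (dividedPow D p.1 a * dividedPow D p.2 b) := by
      rw [Finset.smul_sum, ← Finset.sum_add_distrib]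
      refine Finset.sum_congr rfl fun p hp => ?_
      rw [← add_smul]
      congr 1
      exact_mod_cast (Finset.HasAntidiagonal.mem_antidiagonal.mp hp).symm
    rw [hsplit, Finset.Nat.sum_antidiagonal_succ, Finset.Nat.sum_antidiagonal_succ',
      succ_smul_dividedPow_succ, ih, map_sum]
    simp only [Nat.cast_zero, zero_smul, zero_add, Nat.cast_add, Nat.cast_one]
    rw [← Finset.sum_add_distrib]
    refine Finset.sum_congr rfl fun p _ => ?_
    rw [hD, ← smul_mul_assoc, ← mul_smul_comm, succ_smul_dividedPow_succ,
      succ_smul_dividedPow_succ]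

end DividedPowers

section Flow

variable {k A : Type*} [Field k] [Ring A] [Algebra k A]

theorem dividedPow_eq_zero_of_le {D : A →ₗ[k] A} {a : A} {N n : ℕ}
    (hN : (D ^ N) a = 0) (hn : N ≤ n) : dividedPow D n a = 0 := by
  obtain ⟨m, rfl⟩ := Nat.exists_eq_add_of_le' hn
  simp [dividedPow, pow_add, hN]

/-- The polynomial `exp(tD) a` in `t`, for a locally nilpotent endomorphism `D`. -/
noncomputable def expPoly (D : A →ₗ[k] A) (hnil : ∀ a : A, ∃ N : ℕ, (D ^ N) a = 0) (a : A) :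
    Polynomial A :=
  ∑ m ∈ Finset.range (hnil a).choose, Polynomial.monomial m (dividedPow D m a)

variable {D : A →ₗ[k] A} (hnil : ∀ a : A, ∃ N : ℕ, (D ^ N) a = 0)

theorem coeff_expPoly (a : A) (n : ℕ) : (expPoly D hnil a).coeff n = dividedPow D n a := by
  simp only [expPoly, Polynomial.finsetSum_coeff, Polynomial.coeff_monomial,
    Finset.sum_ite_eq', Finset.mem_range]
  split_ifs with h
  · rfl
  · exact (dividedPow_eq_zero_of_le (hnil a).choose_spec (not_lt.mp h)).symm

/-- The flow `a ↦ exp(tD) a` of a locally nilpotent endomorphism, as a linear map. -/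
noncomputable def expFlow (D : A →ₗ[k] A) (hnil : ∀ a : A, ∃ N : ℕ, (D ^ N) a = 0) :
    A →ₗ[k] Polynomial A where
  toFun := expPoly D hnil
  map_add' a b := by ext n; simp only [Polynomial.coeff_add, coeff_expPoly, map_add]
  map_smul' c a := by
    ext n
    simp only [RingHom.id_apply, Polynomial.coeff_smul, coeff_expPoly, map_smul]

theorem coeff_expFlow (a : A) (n : ℕ) : (expFlow D hnil a).coeff n = dividedPow D n a :=
  coeff_expPoly hnil a n

theorem eval_one_expFlow (a : A) :
    (expFlow D hnil a).eval 1 = ∑ᶠ n : ℕ, (n.factorial : k)⁻¹ • (D ^ n) a := by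
  rw [Polynomial.eval_eq_sum_range, finsum_eq_sum_of_support_subset
    (s := Finset.range ((expFlow D hnil a).natDegree + 1))]
  · simp [coeff_expFlow, dividedPow]
  · intro n hn
    simp only [Finset.coe_range, Set.mem_Iio, Nat.lt_succ_iff]
    refine Polynomial.le_natDegree_of_ne_zero ?_
    rw [coeff_expFlow]
    exact hn

theorem expFlow_apply_of_commute {f : A →ₗ[k] A} (h : Commute D f) (a : A) :
    expFlow D hnil (f a) = cmap f (expFlow D hnil a) := by
  ext n
  rw [coeff_cmap, coeff_expFlow, coeff_expFlow, dividedPow_apply_of_commute h]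

theorem expFlow_of_apply_eq_zero {a : A} (ha : D a = 0) :
    expFlow D hnil a = Polynomial.C a := by
  ext n
  rw [coeff_expFlow, Polynomial.coeff_C]
  split_ifs with h
  · rw [h, dividedPow_zero]
  · exact dividedPow_eq_zero_of_le (N := 1) (by simpa using ha) (Nat.one_le_iff_ne_zero.mpr h)

theorem derivative_expFlow [CharZero k] (a : A) :
    Polynomial.derivative (expFlow D hnil a) = expFlow D hnil (D a) := by
  ext n
  rw [Polynomial.coeff_derivative, coeff_expFlow, coeff_expFlow,
    dividedPow_apply_of_commute (Commute.refl D), ← succ_smul_dividedPow_succ, Algebra.smul_def,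
    map_add, map_natCast, map_one]
  exact_mod_cast ((n + 1).cast_commute _).symm

theorem expFlow_mul [CharZero k] (hD : ∀ a b, D (a * b) = D a * b + a * D b) (a b : A) :
    expFlow D hnil (a * b) = expFlow D hnil a * expFlow D hnil b := by
  ext n
  simp only [Polynomial.coeff_mul, coeff_expFlow, dividedPow_mul hD]

theorem derivation_one (hD : ∀ a b, D (a * b) = D a * b + a * D b) : D 1 = 0 := by
  simpa using hD 1 1

theorem expFlow_one (hD : ∀ a b, D (a * b) = D a * b + a * D b) : expFlow D hnil 1 = 1 := by
  rw [expFlow_of_apply_eq_zero hnil (derivation_one hD), Polynomial.C_1]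

/-- The exponential of a locally nilpotent derivation, as an algebra endomorphism. -/
noncomputable def expHom [CharZero k] (hD : ∀ a b, D (a * b) = D a * b + a * D b) : A →ₐ[k] A :=
  AlgHom.ofLinearMap
    { toFun a := (expFlow D hnil a).eval 1
      map_add' a b := by rw [map_add, Polynomial.eval_add]
      map_smul' c a := by
        rw [map_smul, RingHom.id_apply, Polynomial.eval_smul] }
    (by simp [expFlow_one hnil hD])
    (fun a b => by
      simp only [LinearMap.coe_mk, AddHom.coe_mk, expFlow_mul hnil hD]
      exact Polynomial.eval₂_mul_noncomm _ _ fun _ => Commute.one_right _)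

theorem expHom_apply [CharZero k] (hD : ∀ a b, D (a * b) = D a * b + a * D b) (a : A) :
    expHom hnil hD a = (expFlow D hnil a).eval 1 := rfl

theorem expHom_apply_of_commute [CharZero k] (hD : ∀ a b, D (a * b) = D a * b + a * D b)
    {f : A →ₗ[k] A} (h : Commute D f) (a : A) :
    expHom hnil hD (f a) = f (expHom hnil hD a) := by
  rw [expHom_apply, expHom_apply, expFlow_apply_of_commute hnil h, eval_one_cmap]

theorem expHom_of_apply_eq_zero [CharZero k] (hD : ∀ a b, D (a * b) = D a * b + a * D b)
    {a : A} (ha : D a = 0) : expHom hnil hD a = a := by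
  rw [expHom_apply, expFlow_of_apply_eq_zero hnil ha, Polynomial.eval_C]

theorem expHom_injective [CharZero k] (hD : ∀ a b, D (a * b) = D a * b + a * D b) :
    Function.Injective (expHom hnil hD) := by
  refine (injective_iff_map_eq_zero _).mpr fun a ha => ?_
  obtain ⟨N, hN⟩ := hnil a
  induction N generalizing a with
  | zero => simpa using hN
  | succ N ih =>
    have hDa : D a = 0 := ih (D a)
      (by rw [expHom_apply_of_commute hnil hD (Commute.refl D), ha, map_zero])
      (by rwa [pow_succ, Module.End.mul_apply] at hN)
    rwa [expHom_of_apply_eq_zero hnil hD hDa] at ha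

theorem expHom_surjective [CharZero k] (hD : ∀ a b, D (a * b) = D a * b + a * D b) :
    Function.Surjective (expHom hnil hD) := by
  intro b
  obtain ⟨N, hN⟩ := hnil b
  induction N generalizing b with
  | zero => exact ⟨0, by simpa using hN.symm⟩
  | succ N ih =>
    obtain ⟨c, hc⟩ := ih (b - expHom hnil hD b) (by
      rw [map_sub, ← expHom_apply_of_commute hnil hD (Commute.self_pow D N),
        expHom_of_apply_eq_zero hnil hD (by rwa [pow_succ', Module.End.mul_apply] at hN), sub_self])
    exact ⟨c + b, by rw [map_add, hc, sub_add_cancel]⟩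

/-- The exponential of a locally nilpotent derivation, as an algebra automorphism. -/
noncomputable def expEquiv [CharZero k] (hD : ∀ a b, D (a * b) = D a * b + a * D b) :
    A ≃ₐ[k] A :=
  AlgEquiv.ofBijective (expHom hnil hD) ⟨expHom_injective hnil hD, expHom_surjective hnil hD⟩

theorem expEquiv_apply [CharZero k] (hD : ∀ a b, D (a * b) = D a * b + a * D b) (a : A) :
    expEquiv hnil hD a = (expFlow D hnil a).eval 1 := rfl

end Flow

section Graded

variable {k A : Type*} [Field k] [Ring A] [Algebra k A] {ℬ : ℕ → Submodule k A}

theorem homogeneous_induction (hinternal : DirectSum.IsInternal ℬ) {P : A → Prop}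
    (hom : ∀ i, ∀ a ∈ ℬ i, P a) (hadd : ∀ a b, P a → P b → P (a + b)) (a : A) : P a :=
  Submodule.iSup_induction ℬ (motive := P)
    (hinternal.submodule_iSup_eq_top ▸ Submodule.mem_top : a ∈ ⨆ i, ℬ i)
    hom (hom 0 0 (ℬ 0).zero_mem) hadd

theorem gpiece_natCast (i : ℕ) : gpiece ℬ (i : ℤ) = ℬ i := by simp [gpiece]

theorem gpiece_of_neg {n : ℤ} (hn : n < 0) : gpiece ℬ n = ⊥ := by simp [gpiece, hn]

theorem gpiece_stable {f : A →ₗ[k] A} (hf : ∀ i, ∀ a ∈ ℬ i, f a ∈ ℬ i) (n : ℤ)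
    {a : A} (ha : a ∈ gpiece ℬ n) : f a ∈ gpiece ℬ n := by
  unfold gpiece at ha ⊢
  split_ifs at ha ⊢ with h
  · exact hf _ a ha
  · rw [Submodule.mem_bot] at ha ⊢
    rw [ha, map_zero]

variable {σ : A →ₗ[k] A}

theorem signInvolution_mem (hσ : ∀ i, ∀ a ∈ ℬ i, σ a = ((-1 : k) ^ i) • a)
    (i : ℕ) (a : A) (ha : a ∈ ℬ i) : σ a ∈ ℬ i := by
  rw [hσ i a ha]
  exact (ℬ i).smul_mem _ ha

theorem signInvolution_signInvolution (hinternal : DirectSum.IsInternal ℬ)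
    (hσ : ∀ i, ∀ a ∈ ℬ i, σ a = ((-1 : k) ^ i) • a) (a : A) : σ (σ a) = a := by
  induction a using homogeneous_induction hinternal with
  | hom i a ha =>
    rw [hσ i a ha, map_smul, hσ i a ha, smul_smul, ← mul_pow]
    simp
  | hadd a b ha hb => simp only [map_add, ha, hb]

theorem signInvolution_mul (hinternal : DirectSum.IsInternal ℬ)
    (hgmul : ∀ i j, ℬ i * ℬ j ≤ ℬ (i + j))
    (hσ : ∀ i, ∀ a ∈ ℬ i, σ a = ((-1 : k) ^ i) • a) (a b : A) : σ (a * b) = σ a * σ b := by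
  induction a using homogeneous_induction hinternal with
  | hom i a ha =>
    induction b using homogeneous_induction hinternal with
    | hom j b hb =>
      rw [hσ i a ha, hσ j b hb, hσ (i + j) _ (hgmul i j (Submodule.mul_mem_mul ha hb)),
        smul_mul_smul_comm, pow_add]
    | hadd b c hb hc => simp only [map_add, mul_add, hb, hc]
  | hadd a c ha hc => simp only [map_add, add_mul, ha, hc]

theorem signInvolution_comp_of_degree_one (hinternal : DirectSum.IsInternal ℬ)
    (hσ : ∀ i, ∀ a ∈ ℬ i, σ a = ((-1 : k) ^ i) • a) {d : A →ₗ[k] A}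
    (hd : ∀ i, ∀ a ∈ ℬ i, d a ∈ ℬ (i + 1)) (a : A) : σ (d a) = -d (σ a) := by
  induction a using homogeneous_induction hinternal with
  | hom i a ha => rw [hσ i a ha, hσ _ _ (hd i a ha), map_smul, pow_succ]; simp
  | hadd a b ha hb => simp only [map_add, ha, hb, neg_add]

theorem apply_eq_zero_of_degree_neg_one {G : A →ₗ[k] A}
    (hG : ∀ i : ℕ, ∀ a ∈ ℬ i, G a ∈ gpiece ℬ ((i : ℤ) - 1)) {a : A} (ha : a ∈ ℬ 0) :
    G a = 0 := by
  have h := hG 0 a ha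
  rwa [gpiece_of_neg (by simp), Submodule.mem_bot] at h

theorem apply_mem_of_degree_neg_one {G : A →ₗ[k] A}
    (hG : ∀ i : ℕ, ∀ a ∈ ℬ i, G a ∈ gpiece ℬ ((i : ℤ) - 1)) {i : ℕ} {a : A}
    (ha : a ∈ ℬ (i + 1)) : G a ∈ ℬ i := by
  have h := hG _ a ha
  rwa [Nat.cast_succ, add_sub_cancel_right, gpiece_natCast] at h

theorem signInvolution_comp_of_degree_neg_one (hinternal : DirectSum.IsInternal ℬ)
    (hσ : ∀ i, ∀ a ∈ ℬ i, σ a = ((-1 : k) ^ i) • a) {G : A →ₗ[k] A}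
    (hG : ∀ i : ℕ, ∀ a ∈ ℬ i, G a ∈ gpiece ℬ ((i : ℤ) - 1)) (a : A) : σ (G a) = -G (σ a) := by
  induction a using homogeneous_induction hinternal with
  | hom i a ha =>
    cases i with
    | zero => simp [hσ 0 a ha, apply_eq_zero_of_degree_neg_one hG ha]
    | succ i =>
      rw [hσ _ a ha, hσ i _ (apply_mem_of_degree_neg_one hG ha), map_smul, pow_succ]
      simp
  | hadd a b ha hb => simp only [map_add, ha, hb, neg_add]

theorem leibniz_signInvolution (hinternal : DirectSum.IsInternal ℬ)
    (hσ : ∀ i, ∀ a ∈ ℬ i, σ a = ((-1 : k) ^ i) • a) {d : A →ₗ[k] A}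
    (hd : ∀ i, ∀ a ∈ ℬ i, ∀ b, d (a * b) = d a * b + ((-1 : k) ^ i) • (a * d b)) (a b : A) :
    d (a * b) = d a * b + σ a * d b := by
  induction a using homogeneous_induction hinternal with
  | hom i a ha => rw [hσ i a ha, hd i a ha, smul_mul_assoc]
  | hadd a c ha hc => simp only [map_add, add_mul, ha, hc]; abel

end Graded

/-- in a connected cochain cdga over a field of characteristic zero, for a
graded derivation `G₀` of degree `−1`, the map `D = d∘G₀ + G₀∘d` is a degree-`0` graded
derivation commuting with `d`; and if `D` is locally nilpotent then `exp(D)` is a cdga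
automorphism of `A` homotopic to the identity. -/
theorem exp_bracket_homotopic_to_id
    {k A : Type*} [Field k] [CharZero k] [Ring A] [Algebra k A]
    (ℬ : ℕ → Submodule k A)
    (hinternal : DirectSum.IsInternal ℬ)
    (hconn : ℬ 0 = 1)
    (hgmul : ∀ i j, ℬ i * ℬ j ≤ ℬ (i + j))
    (hcomm : ∀ i j, ∀ a ∈ ℬ i, ∀ b ∈ ℬ j, a * b = ((-1 : k) ^ (i * j)) • (b * a))
    (d : A →ₗ[k] A)
    (hd_deg : ∀ i, ∀ a ∈ ℬ i, d a ∈ ℬ (i + 1))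
    (hd_sq : ∀ a, d (d a) = 0)
    (hd_leib : ∀ i, ∀ a ∈ ℬ i, ∀ b, d (a * b) = d a * b + ((-1 : k) ^ i) • (a * d b))
    (σ : A →ₗ[k] A) (hσ : ∀ i, ∀ a ∈ ℬ i, σ a = ((-1 : k) ^ i) • a)
    (G₀ : A →ₗ[k] A)
    (hG₀_deg : ∀ i : ℕ, ∀ a ∈ ℬ i, G₀ a ∈ gpiece ℬ ((i : ℤ) - 1))
    (hG₀_leib : ∀ i : ℕ, ∀ a ∈ ℬ i, ∀ b : A,
      G₀ (a * b) = G₀ a * b + ((-1 : k) ^ ((-1 : ℤ) * (i : ℤ))) • (a * G₀ b))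
    (D : A →ₗ[k] A) (hDdef : D = d ∘ₗ G₀ + G₀ ∘ₗ d) :
    (∀ i : ℕ, ∀ a ∈ ℬ i, D a ∈ ℬ i) ∧
    (∀ a b : A, D (a * b) = D a * b + a * D b) ∧
    (D ∘ₗ d = d ∘ₗ D) ∧
    ((∀ a : A, ∃ N : ℕ, (D ^ N) a = 0) →
      ∃ Φ : A ≃ₐ[k] A,
        (∀ a : A, Φ a = ∑ᶠ n : ℕ, (n.factorial : k)⁻¹ • (D ^ n) a) ∧
        (∀ i : ℕ, ∀ a ∈ ℬ i, Φ a ∈ ℬ i) ∧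
        (∀ a : A, Φ (d a) = d (Φ a)) ∧
        IsHomotopicToId ℬ d σ ⇑Φ) := by
  have hG₀_leib' : ∀ i, ∀ a ∈ ℬ i, ∀ b,
      G₀ (a * b) = G₀ a * b + ((-1 : k) ^ i) • (a * G₀ b) := by
    intro i a ha b
    rw [hG₀_leib i a ha b, neg_one_mul, zpow_neg, zpow_natCast, ← inv_pow, inv_neg_one]
  have hd := leibniz_signInvolution hinternal hσ hd_leib
  have hG₀ := leibniz_signInvolution hinternal hσ hG₀_leib'
  have hσσ := signInvolution_signInvolution hinternal hσ
  have hσmul := signInvolution_mul hinternal hgmul hσ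
  have hσd := signInvolution_comp_of_degree_one hinternal hσ hd_deg
  have hσG := signInvolution_comp_of_degree_neg_one hinternal hσ hG₀_deg
  have hDa (a : A) : D a = d (G₀ a) + G₀ (d a) := by simp [hDdef]
  have hD_deg : ∀ i : ℕ, ∀ a ∈ ℬ i, D a ∈ ℬ i := by
    intro i a ha
    rw [hDa]
    refine (ℬ i).add_mem ?_ (apply_mem_of_degree_neg_one hG₀_deg (hd_deg i a ha))
    cases i with
    | zero => simp [apply_eq_zero_of_degree_neg_one hG₀_deg ha]
    | succ i => exact hd_deg i _ (apply_mem_of_degree_neg_one hG₀_deg ha)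
  have hD : ∀ a b : A, D (a * b) = D a * b + a * D b := by
    intro a b
    simp only [hDa, hd, hG₀, map_add, hσσ, hσd, hσG, add_mul, mul_add, neg_mul]
    abel
  have hDd : Commute D d := LinearMap.ext fun a => by simp [hDa, hd_sq]
  have hDσ : Commute D σ := LinearMap.ext fun a => by simp [hDa, hσd, hσG]
  refine ⟨hD_deg, hD, hDd, fun hnil => ?_⟩
  have hcoeff_mem : ∀ i : ℕ, ∀ a ∈ ℬ i, ∀ n : ℕ, (expFlow D hnil a).coeff n ∈ ℬ i := by
    intro i a ha n
    rw [coeff_expFlow]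
    exact dividedPow_mem (hD_deg i) n ha
  refine ⟨expEquiv hnil hD, eval_one_expFlow hnil, fun i a ha => ?_,
    expHom_apply_of_commute hnil hD hDd, expFlow D hnil, expFlow D hnil ∘ₗ σ ∘ₗ G₀,
    expFlow_mul hnil hD, fun a b => ?_, expFlow_one hnil hD, ?_,
    expFlow_apply_of_commute hnil hDd, fun a => ?_, hcoeff_mem, fun i a ha n => ?_,
    fun a => ?_, fun a => rfl⟩
  · rw [expEquiv_apply, Polynomial.eval_eq_sum_range]
    exact (ℬ i).sum_mem fun n _ => by simpa using hcoeff_mem i a ha n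
  · simp only [LinearMap.comp_apply, ← expFlow_apply_of_commute hnil hDσ,
      ← expFlow_mul hnil hD, ← map_add]
    rw [hG₀, map_add, hσmul, hσmul, hσσ, add_comm]
  · have h1 : (1 : A) ∈ ℬ 0 := by rw [hconn]; exact Submodule.one_le.mp le_rfl
    simp [apply_eq_zero_of_degree_neg_one hG₀_deg h1]
  · simp only [LinearMap.comp_apply, ← expFlow_apply_of_commute hnil hDσ,
      ← expFlow_apply_of_commute hnil hDd, derivative_expFlow, ← map_add]
    congr 1
    simp only [hDa, hσd, hσG, map_neg, neg_neg]
    abel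
  · rw [LinearMap.comp_apply, coeff_expFlow]
    exact dividedPow_mem (fun b => gpiece_stable hD_deg _) n
      (gpiece_stable (signInvolution_mem hσ) _ (hG₀_deg i a ha))
  · rw [coeff_expFlow, dividedPow_zero]
end

section
/- Fix a field k of characteristic zero. Let (A, ℬ, d_A) and (B, ℬ', d_B) be connected cochain cdgas over k which are minimal and simply connected: each is free graded-commutative on a graded k-subspace of elements of degree ≥ 2 (the canonical algebra map from the tensor product of the polynomial algebra on the even-degree part and the exterior algebra on the odd-degree part of that subspace is a degree-preserving algebra isomorphism), ℬ 1 = 0 = ℬ' 1, and the differentials are decomposable: d_A(A) ⊆ A₊·A₊ and d_B(B) ⊆ B₊·B₊, where A₊ (resp. B₊) is the ideal of positive-degree elements. If f : A → B is a morphism of cdgas (a degree-preserving k-algebra homomorphism with f ∘ d_A = d_B ∘ f) which is a quasi-isomorphism, i.e. induces an isomorphism ker(d_A)/im(d_A) → ker(d_B)/im(d_B) in every degree, then f is an isomorphism of cdgas. -/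
open TensorProduct

section GradedSubmodules

variable {k R : Type*} [Field k] [Ring R] [Algebra k R] (𝒜 : ℕ → Submodule k R)

/-- A homogeneous element of a product of two positively graded parts is a sum of products of
homogeneous elements of complementary positive degrees. -/
theorem mem_of_mem_mul_positive (hint : DirectSum.IsInternal 𝒜)
    (hmul : ∀ i j, 𝒜 i * 𝒜 j ≤ 𝒜 (i + j)) (m : ℕ) (T : Submodule k R)
    (hT : ∀ i j, 0 < i → 0 < j → i + j = m → ∀ u ∈ 𝒜 i, ∀ v ∈ 𝒜 j, u * v ∈ T)
    {z : R} (hz : z ∈ 𝒜 m)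
    (hz' : z ∈ (⨆ i, ⨆ _ : 0 < i, 𝒜 i) * (⨆ i, ⨆ _ : 0 < i, 𝒜 i)) : z ∈ T := by
  classical
  let _ := hint.chooseDecomposition
  have key : ∀ w ∈ (⨆ i, ⨆ _ : 0 < i, 𝒜 i) * (⨆ i, ⨆ _ : 0 < i, 𝒜 i),
      ((DirectSum.decompose 𝒜 w m : 𝒜 m) : R) ∈ T := by
    have hle : (⨆ i, ⨆ _ : 0 < i, 𝒜 i) * (⨆ i, ⨆ _ : 0 < i, 𝒜 i) ≤
        T.comap ((𝒜 m).subtype ∘ₗ (DirectSum.component k ℕ (fun i => 𝒜 i) m) ∘ₗ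
          (DirectSum.decomposeLinearEquiv 𝒜).toLinearMap) := by
      simp only [Submodule.iSup_mul, Submodule.mul_iSup, iSup_le_iff]
      intro i hi j hj
      rw [Submodule.mul_le]
      intro u hu v hv
      have huv : u * v ∈ 𝒜 (j + i) := hmul _ _ (Submodule.mul_mem_mul hu hv)
      change ((DirectSum.decompose 𝒜 (u * v) m : 𝒜 m) : R) ∈ T
      by_cases h : j + i = m
      · subst h
        rw [DirectSum.decompose_of_mem_same 𝒜 huv]
        exact hT _ _ hj hi rfl u hu v hv
      · rw [DirectSum.decompose_of_mem_ne 𝒜 huv h]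
        exact T.zero_mem
    exact fun w hw => hle hw
  simpa [DirectSum.decompose_of_mem_same 𝒜 hz] using key z hz'

/-- A graded family of subspaces of the homogeneous pieces which together span everything exhausts
every homogeneous piece. -/
theorem mem_of_le_of_iSup_eq_top (hint : DirectSum.IsInternal 𝒜) (𝒞 : ℕ → Submodule k R)
    (hle : ∀ i, 𝒞 i ≤ 𝒜 i) (htop : ⨆ i, 𝒞 i = ⊤) {i : ℕ} {z : R} (hz : z ∈ 𝒜 i) :
    z ∈ 𝒞 i := by
  classical
  let _ := hint.chooseDecomposition
  have key : (⨆ j, 𝒞 j) ≤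
      (𝒞 i).comap ((𝒜 i).subtype ∘ₗ (DirectSum.component k ℕ (fun i => 𝒜 i) i) ∘ₗ
        (DirectSum.decomposeLinearEquiv 𝒜).toLinearMap) := by
    rw [iSup_le_iff]
    intro j w hw
    change ((DirectSum.decompose 𝒜 w i : 𝒜 i) : R) ∈ 𝒞 i
    by_cases h : j = i
    · subst h
      rwa [DirectSum.decompose_of_mem_same 𝒜 (hle _ hw)]
    · rw [DirectSum.decompose_of_mem_ne 𝒜 (hle _ hw) h]
      exact Submodule.zero_mem _
  have h : z ∈ ⨆ j, 𝒞 j := htop ▸ Submodule.mem_top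
  have h' : ((DirectSum.decompose 𝒜 z i : 𝒜 i) : R) ∈ 𝒞 i := key h
  rwa [DirectSum.decompose_of_mem_same 𝒜 hz] at h'

/-- A degree-preserving linear map which is bijective in each degree is bijective. -/
theorem bijective_of_bijective_homogeneous {R' : Type*} [Ring R'] [Algebra k R']
    (𝒜' : ℕ → Submodule k R') (hint : DirectSum.IsInternal 𝒜) (hint' : DirectSum.IsInternal 𝒜')
    (f : R →ₗ[k] R') (hf : ∀ i, ∀ a ∈ 𝒜 i, f a ∈ 𝒜' i)
    (hinj : ∀ i, ∀ a ∈ 𝒜 i, f a = 0 → a = 0) (hsurj : ∀ i, ∀ b ∈ 𝒜' i, ∃ a ∈ 𝒜 i, f a = b) :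
    Function.Bijective f := by
  classical
  let _ := hint.chooseDecomposition
  let _ := hint'.chooseDecomposition
  constructor
  · have hcomm : ∀ (a : R) (i : ℕ), f (DirectSum.decompose 𝒜 a i : 𝒜 i) =
        (DirectSum.decompose 𝒜' (f a) i : 𝒜' i) := by
      intro a i
      induction a using DirectSum.Decomposition.inductionOn 𝒜 with
      | zero => simp
      | @homogeneous j m =>
        by_cases h : j = i
        · subst h
          rw [DirectSum.decompose_of_mem_same 𝒜 m.2,
            DirectSum.decompose_of_mem_same 𝒜' (hf _ _ m.2)]
        · rw [DirectSum.decompose_of_mem_ne 𝒜 m.2 h,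
            DirectSum.decompose_of_mem_ne 𝒜' (hf _ _ m.2) h, map_zero]
      | add a b ha hb => simp [DirectSum.decompose_add, ha, hb]
    rw [injective_iff_map_eq_zero]
    intro a ha
    apply (DirectSum.decompose 𝒜).injective
    rw [DirectSum.decompose_zero]
    ext i
    refine hinj i _ (Subtype.prop _) ?_
    rw [hcomm, ha]
    simp
  · rw [← LinearMap.range_eq_top, eq_top_iff, ← hint'.submodule_iSup_eq_top, iSup_le_iff]
    intro i b hb
    obtain ⟨a, -, rfl⟩ := hsurj i b hb
    exact ⟨a, rfl⟩

end GradedSubmodules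

section FreeGradedCommutative

variable {k A B J : Type*} [Field k] [Ring A] [Algebra k A] [Ring B] [Algebra k B]
  {degJ : J → ℕ} {y : J → B}
  (e : (MvPolynomial {α : J // Even (degJ α)} k ⊗[k]
        ExteriorAlgebra k ({α : J // Odd (degJ α)} →₀ k)) ≃ₐ[k] B)
  (he_even : ∀ β : {α : J // Even (degJ α)}, e (MvPolynomial.X β ⊗ₜ[k] 1) = y β)
  (he_odd : ∀ β : {α : J // Odd (degJ α)},
      e (1 ⊗ₜ[k] ExteriorAlgebra.ι k (Finsupp.single β 1)) = y β)

include he_even he_odd in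
/-- A free graded-commutative algebra is generated by its generators. -/
theorem subalgebra_eq_top_of_generators_mem (S : Subalgebra k B) (hS : ∀ α, y α ∈ S) : S = ⊤ := by
  have hpoly : (S.comap e.toAlgHom).comap Algebra.TensorProduct.includeLeft = ⊤ := by
    rw [eq_top_iff, ← MvPolynomial.adjoin_range_X, Algebra.adjoin_le_iff]
    rintro _ ⟨β, rfl⟩
    change e (MvPolynomial.X β ⊗ₜ[k] 1) ∈ S
    exact he_even β ▸ hS β
  have hext : (S.comap e.toAlgHom).comap Algebra.TensorProduct.includeRight = ⊤ := by
    rw [eq_top_iff, ← CliffordAlgebra.adjoin_range_ι, Algebra.adjoin_le_iff]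
    rintro _ ⟨v, rfl⟩
    change e (1 ⊗ₜ[k] ExteriorAlgebra.ι k v) ∈ S
    induction v using Finsupp.induction_linear with
    | zero => simp
    | add v w hv hw => rw [map_add, TensorProduct.tmul_add, map_add]; exact S.add_mem hv hw
    | single β c =>
      rw [← mul_one c, ← smul_eq_mul, ← Finsupp.smul_single, map_smul, TensorProduct.tmul_smul,
        map_smul, he_odd]
      exact S.smul_mem (hS β) c
  have hall : ∀ t, e t ∈ S := by
    intro t
    induction t using TensorProduct.induction_on with
    | zero => simp
    | add s t hs ht => rw [map_add]; exact S.add_mem hs ht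
    | tmul p q =>
      have hp : e (p ⊗ₜ[k] 1) ∈ S := by
        have : p ∈ (S.comap e.toAlgHom).comap Algebra.TensorProduct.includeLeft :=
          hpoly ▸ Algebra.mem_top
        exact this
      have hq : e (1 ⊗ₜ[k] q) ∈ S := by
        have : q ∈ (S.comap e.toAlgHom).comap Algebra.TensorProduct.includeRight :=
          hext ▸ Algebra.mem_top
        exact this
      have hpq : p ⊗ₜ[k] q = (p ⊗ₜ[k] 1) * (1 ⊗ₜ[k] q) := by simp
      rw [hpq, map_mul]
      exact S.mul_mem hp hq
  rw [eq_top_iff]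
  intro b _
  simpa using hall (e.symm b)

include he_even he_odd in
/-- The universal property of free graded-commutative algebras in characteristic zero: homogeneous
images of the generators may be prescribed freely. -/
theorem exists_algHom_of_generators [CharZero k] (𝒜 : ℕ → Submodule k A)
    (hint : DirectSum.IsInternal 𝒜)
    (hcomm : ∀ i j, ∀ a ∈ 𝒜 i, ∀ b ∈ 𝒜 j, a * b = ((-1 : k) ^ (i * j)) • (b * a))
    (z : J → A) (hz : ∀ α, z α ∈ 𝒜 (degJ α)) :
    ∃ g : B →ₐ[k] A, ∀ α, g (y α) = z α := by
  have hcenter : ∀ β : {α : J // Even (degJ α)}, z β ∈ Subalgebra.center k A := by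
    intro β
    rw [Subalgebra.mem_center_iff]
    intro b
    have hb : b ∈ ⨆ i, 𝒜 i := hint.submodule_iSup_eq_top ▸ Submodule.mem_top
    induction hb using Submodule.iSup_induction' with
    | mem i b hb =>
      rw [hcomm _ _ b hb _ (hz β), Even.neg_one_pow (β.2.mul_left i), one_smul]
    | zero => simp
    | add b c _ _ hb hc => rw [add_mul, mul_add, hb, hc]
  let φ : ({α : J // Odd (degJ α)} →₀ k) →ₗ[k] A :=
    Finsupp.linearCombination k (fun β => z β)
  have hanti : ∀ v w, φ v * φ w = -(φ w * φ v) := by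
    intro v w
    induction v using Finsupp.induction_linear with
    | zero => simp
    | add v v' hv hv' => rw [map_add, add_mul, mul_add, hv, hv', neg_add]
    | single β c =>
      induction w using Finsupp.induction_linear with
      | zero => simp
      | add w w' hw hw' => rw [map_add, add_mul, mul_add, hw, hw', neg_add]
      | single γ c' =>
        simp only [φ, Finsupp.linearCombination_single, smul_mul_smul_comm]
        rw [hcomm _ _ _ (hz β) _ (hz γ), Odd.neg_one_pow (β.2.mul γ.2), mul_comm c]
        simp
  have hsq : ∀ v, φ v * φ v = 0 := by
    intro v
    have h2 : (2 : k) • (φ v * φ v) = 0 := by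
      rw [two_smul]
      nth_rewrite 1 [hanti v v]
      exact neg_add_cancel _
    exact (smul_eq_zero.mp h2).resolve_left two_ne_zero
  let ψ : MvPolynomial {α : J // Even (degJ α)} k →ₐ[k] Subalgebra.center k A :=
    MvPolynomial.aeval fun β => ⟨z β, hcenter β⟩
  let g : (MvPolynomial {α : J // Even (degJ α)} k ⊗[k]
        ExteriorAlgebra k ({α : J // Odd (degJ α)} →₀ k)) →ₐ[k] A :=
    Algebra.TensorProduct.lift ((Subalgebra.center k A).val.comp ψ)
      (ExteriorAlgebra.lift k ⟨φ, hsq⟩)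
      fun p q => ((Subalgebra.mem_center_iff.mp (ψ p).2) _).symm
  refine ⟨g.comp e.symm.toAlgHom, fun α => ?_⟩
  rcases Nat.even_or_odd (degJ α) with h | h
  · have : e.symm (y α) = MvPolynomial.X ⟨α, h⟩ ⊗ₜ[k] 1 := by
      rw [AlgEquiv.symm_apply_eq]; exact (he_even ⟨α, h⟩).symm
    change g (e.symm (y α)) = z α
    rw [this]
    exact (Algebra.TensorProduct.lift_tmul _ _ _ _ _).trans (by simp [ψ])
  · have : e.symm (y α) = 1 ⊗ₜ[k] ExteriorAlgebra.ι k (Finsupp.single ⟨α, h⟩ 1) := by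
      rw [AlgEquiv.symm_apply_eq]; exact (he_odd ⟨α, h⟩).symm
    change g (e.symm (y α)) = z α
    rw [this]
    exact (Algebra.TensorProduct.lift_tmul _ _ _ _ _).trans (by simp [φ])

include he_even he_odd in
/-- If a degree-preserving morphism `f` to a free graded-commutative algebra is bijective in degrees
below `n`, it has a retraction on the homogeneous pieces of degree below `n` which is an algebra
homomorphism. -/
theorem exists_algHom_leftInverse_below [CharZero k]
    (𝒜 : ℕ → Submodule k A) (hintA : DirectSum.IsInternal 𝒜)
    (hone : 1 ∈ 𝒜 0) (hmulA : ∀ i j, 𝒜 i * 𝒜 j ≤ 𝒜 (i + j))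
    (hcomm : ∀ i j, ∀ a ∈ 𝒜 i, ∀ b ∈ 𝒜 j, a * b = ((-1 : k) ^ (i * j)) • (b * a))
    (𝒜' : ℕ → Submodule k B) (hintB : DirectSum.IsInternal 𝒜')
    (hone' : 1 ∈ 𝒜' 0) (hmulB : ∀ i j, 𝒜' i * 𝒜' j ≤ 𝒜' (i + j))
    (hy : ∀ α, y α ∈ 𝒜' (degJ α))
    (f : A →ₐ[k] B) (hf : ∀ i, ∀ a ∈ 𝒜 i, f a ∈ 𝒜' i) (n : ℕ)
    (hinj : ∀ i < n, ∀ a ∈ 𝒜 i, f a = 0 → a = 0)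
    (hsurj : ∀ i < n, ∀ b ∈ 𝒜' i, ∃ a ∈ 𝒜 i, f a = b) :
    ∃ g : B →ₐ[k] A, ∀ i < n, ∀ a ∈ 𝒜 i, g (f a) = a := by
  have hlift : ∀ α, ∃ a ∈ 𝒜 (degJ α), degJ α < n → f a = y α := by
    intro α
    by_cases h : degJ α < n
    · obtain ⟨a, ha, hfa⟩ := hsurj _ h _ (hy α)
      exact ⟨a, ha, fun _ => hfa⟩
    · exact ⟨0, zero_mem _, fun h' => absurd h' h⟩
  choose z hz hfz using hlift
  obtain ⟨g, hg⟩ := exists_algHom_of_generators e he_even he_odd 𝒜 hintA hcomm z hz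
  let 𝒞 : ℕ → Submodule k B := fun i =>
    { carrier := {b | b ∈ 𝒜' i ∧ g b ∈ 𝒜 i ∧ (i < n → f (g b) = b)}
      zero_mem' := by simp
      add_mem' := fun {a b} ha hb => ⟨add_mem ha.1 hb.1, by
        rw [map_add]; exact add_mem ha.2.1 hb.2.1, fun h => by
        rw [map_add, map_add, ha.2.2 h, hb.2.2 h]⟩
      smul_mem' := fun c b hb => ⟨Submodule.smul_mem _ c hb.1, by
        rw [map_smul]; exact Submodule.smul_mem _ c hb.2.1, fun h => by
        rw [map_smul, map_smul, hb.2.2 h]⟩ }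
  have : SetLike.GradedMonoid 𝒞 :=
    { one_mem := ⟨hone', by rwa [map_one], fun _ => by simp⟩
      mul_mem := fun i j a b ha hb => ⟨hmulB _ _ (Submodule.mul_mem_mul ha.1 hb.1), by
        rw [map_mul]; exact hmulA _ _ (Submodule.mul_mem_mul ha.2.1 hb.2.1), fun h => by
        rw [map_mul, map_mul, ha.2.2 (by omega), hb.2.2 (by omega)]⟩ }
  have htop : ⨆ i, 𝒞 i = ⊤ := by
    classical
    rw [Submodule.iSup_eq_toSubmodule_range,
      subalgebra_eq_top_of_generators_mem e he_even he_odd (DirectSum.coeAlgHom 𝒞).range]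
    · rfl
    · intro α
      have hα : y α ∈ 𝒞 (degJ α) :=
        ⟨hy α, by rw [hg]; exact hz α, fun h => by rw [hg]; exact hfz α h⟩
      rw [← Subalgebra.mem_toSubmodule, ← Submodule.iSup_eq_toSubmodule_range]
      exact Submodule.mem_iSup_of_mem _ hα
  refine ⟨g, fun i hi a ha => ?_⟩
  have hfa : f a ∈ 𝒞 i :=
    mem_of_le_of_iSup_eq_top 𝒜' hintB 𝒞 (fun _ _ h => h.1) htop (hf i a ha)
  refine sub_eq_zero.mp (hinj i hi _ (sub_mem hfa.2.1 ha) ?_)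
  rw [map_sub, hfa.2.2 hi, sub_self]

end FreeGradedCommutative

/-- a quasi-isomorphism between minimal, simply connected connected cochain
cdgas over a field of characteristic zero is an isomorphism. -/
theorem quasi_iso_of_minimal_is_iso
    {k A B : Type*} [Field k] [CharZero k] [Ring A] [Algebra k A] [Ring B] [Algebra k B]
    -- the cdga structure on A
    (ℬ : ℕ → Submodule k A)
    (hinternalA : DirectSum.IsInternal ℬ)
    (hconnA : ℬ 0 = 1)
    (hgmulA : ∀ i j, ℬ i * ℬ j ≤ ℬ (i + j))
    (hcommA : ∀ i j, ∀ a ∈ ℬ i, ∀ b ∈ ℬ j, a * b = ((-1 : k) ^ (i * j)) • (b * a))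
    (dA : A →ₗ[k] A)
    (hdA_deg : ∀ i, ∀ a ∈ ℬ i, dA a ∈ ℬ (i + 1))
    (hdA_sq : ∀ a, dA (dA a) = 0)
    (hdA_leib : ∀ i, ∀ a ∈ ℬ i, ∀ b, dA (a * b) = dA a * b + ((-1 : k) ^ i) • (a * dA b))
    -- the cdga structure on B
    (ℬ' : ℕ → Submodule k B)
    (hinternalB : DirectSum.IsInternal ℬ')
    (hconnB : ℬ' 0 = 1)
    (hgmulB : ∀ i j, ℬ' i * ℬ' j ≤ ℬ' (i + j))
    (hcommB : ∀ i j, ∀ a ∈ ℬ' i, ∀ b ∈ ℬ' j, a * b = ((-1 : k) ^ (i * j)) • (b * a))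
    (dB : B →ₗ[k] B)
    (hdB_deg : ∀ i, ∀ b ∈ ℬ' i, dB b ∈ ℬ' (i + 1))
    (hdB_sq : ∀ b, dB (dB b) = 0)
    (hdB_leib : ∀ i, ∀ a ∈ ℬ' i, ∀ b, dB (a * b) = dB a * b + ((-1 : k) ^ i) • (a * dB b))
    -- simple connectivity
    (hA1 : ℬ 1 = ⊥) (hB1 : ℬ' 1 = ⊥)
    -- A is free graded-commutative on generators of degree ≥ 2
    (I : Type*) (degI : I → ℕ) (hdegI : ∀ α, 2 ≤ degI α)
    (x : I → A) (hx : ∀ α, x α ∈ ℬ (degI α))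
    (eA : (MvPolynomial {α : I // Even (degI α)} k ⊗[k]
        ExteriorAlgebra k ({α : I // Odd (degI α)} →₀ k)) ≃ₐ[k] A)
    (heA_even : ∀ β : {α : I // Even (degI α)}, eA (MvPolynomial.X β ⊗ₜ[k] 1) = x β)
    (heA_odd : ∀ β : {α : I // Odd (degI α)},
      eA (1 ⊗ₜ[k] ExteriorAlgebra.ι k (Finsupp.single β 1)) = x β)
    -- B is free graded-commutative on generators of degree ≥ 2
    (J : Type*) (degJ : J → ℕ) (hdegJ : ∀ α, 2 ≤ degJ α)
    (y : J → B) (hy : ∀ α, y α ∈ ℬ' (degJ α))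
    (eB : (MvPolynomial {α : J // Even (degJ α)} k ⊗[k]
        ExteriorAlgebra k ({α : J // Odd (degJ α)} →₀ k)) ≃ₐ[k] B)
    (heB_even : ∀ β : {α : J // Even (degJ α)}, eB (MvPolynomial.X β ⊗ₜ[k] 1) = y β)
    (heB_odd : ∀ β : {α : J // Odd (degJ α)},
      eB (1 ⊗ₜ[k] ExteriorAlgebra.ι k (Finsupp.single β 1)) = y β)
    -- minimality: the differentials are decomposable
    (hminA : ∀ a : A, dA a ∈ (⨆ i, ⨆ _ : 0 < i, ℬ i) * (⨆ i, ⨆ _ : 0 < i, ℬ i))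
    (hminB : ∀ b : B, dB b ∈ (⨆ i, ⨆ _ : 0 < i, ℬ' i) * (⨆ i, ⨆ _ : 0 < i, ℬ' i))
    -- f is a morphism of cdgas
    (f : A →ₐ[k] B)
    (hf_deg : ∀ i, ∀ a ∈ ℬ i, f a ∈ ℬ' i)
    (hf_d : ∀ a, f (dA a) = dB (f a))
    -- f is a quasi-isomorphism: it induces an isomorphism on cohomology in every degree
    (hsurj : ∀ i : ℕ, ∀ b ∈ ℬ' i, dB b = 0 →
      ∃ a ∈ ℬ i, dA a = 0 ∧ ∃ c ∈ gpiece ℬ' ((i : ℤ) - 1), b - f a = dB c)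
    (hinj : ∀ i : ℕ, ∀ a ∈ ℬ i, dA a = 0 →
      (∃ c ∈ gpiece ℬ' ((i : ℤ) - 1), f a = dB c) →
      ∃ c' ∈ gpiece ℬ ((i : ℤ) - 1), a = dA c') :
    Function.Bijective f := by
  have hone : (1 : A) ∈ ℬ 0 := hconnA ▸ Submodule.one_le.mp le_rfl
  have hone' : (1 : B) ∈ ℬ' 0 := hconnB ▸ Submodule.one_le.mp le_rfl
  have main : ∀ n : ℕ, (∀ a ∈ ℬ n, f a = 0 → a = 0) ∧ (∀ b ∈ ℬ' n, ∃ a ∈ ℬ n, f a = b) := by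
    intro n
    induction n using Nat.strong_induction_on with
    | _ n ih =>
    obtain ⟨g, hg⟩ := exists_algHom_leftInverse_below eB heB_even heB_odd ℬ hinternalA hone hgmulA
      hcommA ℬ' hinternalB hone' hgmulB hy f hf_deg n (fun i hi => (ih i hi).1)
      (fun i hi => (ih i hi).2)
    -- `f` is injective on the subalgebra where `g` is a retraction of it
    let S : Subalgebra k A := AlgHom.equalizer (g.comp f) (AlgHom.id k A)
    have hS_inj : ∀ a ∈ S, f a = 0 → a = 0 := by
      intro a ha hfa
      have : g (f a) = a := ha
      rw [← this, hfa, map_zero]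
    have hS_low : ∀ i < n, ∀ a ∈ ℬ i, a ∈ S := fun i hi a ha => hg i hi a ha
    have hS_d : ∀ i ≤ n, ∀ a ∈ ℬ i, dA a ∈ S := by
      intro i hi a ha
      refine mem_of_mem_mul_positive ℬ hinternalA hgmulA (i + 1) (Subalgebra.toSubmodule S) ?_
        (hdA_deg i a ha) (hminA a)
      intro p q hp hq hpq u hu v hv
      by_cases h1 : p = 1
      · subst h1
        rw [hA1, Submodule.mem_bot] at hu
        simp [hu]
      by_cases h2 : q = 1
      · subst h2
        rw [hA1, Submodule.mem_bot] at hv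
        simp [hv]
      exact S.mul_mem (hS_low p (by omega) u hu) (hS_low q (by omega) v hv)
    have hS_gpiece : ∀ c ∈ gpiece ℬ ((n : ℤ) - 1), dA c ∈ S := by
      intro c hc
      unfold gpiece at hc
      split_ifs at hc with h
      · exact hS_d _ (by omega) c hc
      · rw [Submodule.mem_bot] at hc
        simp [hc]
    constructor
    · intro a ha hfa
      have hda : dA a = 0 := hS_inj _ (hS_d n le_rfl a ha) (by rw [hf_d, hfa, map_zero])
      obtain ⟨c, hc, rfl⟩ := hinj n a ha hda ⟨0, zero_mem _, by rw [hfa, map_zero]⟩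
      exact hS_inj _ (hS_gpiece c hc) hfa
    · intro b hb
      have hlift : dB b ∈
          (ℬ (n + 1) ⊓ (Subalgebra.toSubmodule S).comap dA).map f.toLinearMap := by
        refine mem_of_mem_mul_positive ℬ' hinternalB hgmulB (n + 1) _ ?_ (hdB_deg n b hb) (hminB b)
        intro p q hp hq hpq u hu v hv
        by_cases h1 : p = 1
        · subst h1
          rw [hB1, Submodule.mem_bot] at hu
          simp [hu]
        by_cases h2 : q = 1
        · subst h2
          rw [hB1, Submodule.mem_bot] at hv
          simp [hv]
        have hpn : p < n := by omega
        have hqn : q < n := by omega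
        obtain ⟨u', hu', rfl⟩ := (ih p hpn).2 u hu
        obtain ⟨v', hv', rfl⟩ := (ih q hqn).2 v hv
        refine ⟨u' * v', ⟨hpq ▸ hgmulA _ _ (Submodule.mul_mem_mul hu' hv'), ?_⟩, map_mul f _ _⟩
        change dA (u' * v') ∈ S
        rw [hdA_leib p u' hu']
        exact S.add_mem (S.mul_mem (hS_d p hpn.le u' hu') (hS_low q hqn v' hv'))
          (S.smul_mem (S.mul_mem (hS_low p hpn u' hu') (hS_d q hqn.le v' hv')) _)
      obtain ⟨a, ⟨ha, hdaS⟩, hfa⟩ := hlift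
      change f a = dB b at hfa
      have hda : dA a = 0 := hS_inj _ hdaS (by rw [hf_d, hfa, hdB_sq])
      have hgp : ((n + 1 : ℕ) : ℤ) - 1 = n := by simp
      obtain ⟨a₁, ha₁, rfl⟩ := hinj (n + 1) a ha hda ⟨b, by rw [hgp]; simpa [gpiece] using hb, hfa⟩
      replace ha₁ : a₁ ∈ ℬ n := by rw [hgp] at ha₁; simpa [gpiece] using ha₁
      obtain ⟨a₂, ha₂, -, c, hc, hbc⟩ := hsurj n (b - f a₁) (sub_mem hb (hf_deg n a₁ ha₁))
        (by rw [map_sub, ← hfa, hf_d, sub_self])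
      have hc_lift : ∃ c' , dA c' ∈ ℬ n ∧ f c' = c := by
        unfold gpiece at hc
        split_ifs at hc with h
        · obtain ⟨c', hc', hfc⟩ := (ih ((n : ℤ) - 1).toNat (by omega)).2 c hc
          have hn : ((n : ℤ) - 1).toNat + 1 = n := by omega
          exact ⟨c', hn ▸ hdA_deg _ c' hc', hfc⟩
        · rw [Submodule.mem_bot] at hc
          exact ⟨0, by simp, by simp [hc]⟩
      obtain ⟨c', hc', rfl⟩ := hc_lift
      refine ⟨dA c' + a₂ + a₁, add_mem (add_mem hc' ha₂) ha₁, ?_⟩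
      rw [map_add, map_add, hf_d, ← hbc]
      abel
  exact bijective_of_bijective_homogeneous ℬ ℬ' hinternalA hinternalB f.toLinearMap hf_deg
    (fun i => (main i).1) (fun i => (main i).2)
end
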